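/- arXiv:2505.18692 — 8 statements merged into one kernel-verified Lean document; each statement's English description precedes it below -/
import Mathlib

section
/- Let A be a unital complex *-algebra and X a right A-module that is finitely generated and projective, equipped with an inner product ⟨·,·⟩ : X × X → A that is additive in each argument and satisfies ⟨x, y·a⟩ = ⟨x,y⟩·a and ⟨x,y⟩* = ⟨y,x⟩ for all a ∈ A, x,y ∈ X, and which is strongly non-degenerate: for every right A-module map f : X → A there exists a unique z ∈ X with f(y) = ⟨z,y⟩ for all y ∈ X. Then there exist n ∈ ℕ and elements x₁,…,xₙ, x'₁,…,x'ₙ ∈ X (a generating pair) such that for every x ∈ X one has x = Σᵢ xᵢ·⟨x'ᵢ,x⟩ = Σᵢ x'ᵢ·⟨xᵢ,x⟩. -/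
open MulOpposite

/-- A finite projective module has a finite dual basis. -/
lemma Module.Finite.exists_dual_basis_of_projective (R M : Type*) [Ring R] [AddCommGroup M]
    [Module R M] [Module.Finite R M] [Module.Projective R M] :
    ∃ (n : ℕ) (x : Fin n → M) (φ : Fin n → M →ₗ[R] R), ∀ v : M, v = ∑ i, φ i v • x i := by
  obtain ⟨n, f, g, -, -, hfg⟩ := Module.Finite.exists_comp_eq_id_of_projective R M
  refine ⟨n, fun i => f fun j => if i = j then 1 else 0, fun i => LinearMap.proj i ∘ₗ g,
    fun v => ?_⟩
  exact (LinearMap.congr_fun hfg v).symm.trans (LinearMap.pi_apply_eq_sum_univ f (g v))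

/-- A finitely generated projective right module over a unital complex
`*`-algebra with a strongly non-degenerate Hermitian `A`-valued inner product admits a
generating pair `{(xᵢ, x'ᵢ)}` reconstructing every element. -/
theorem generating_pair_exists
    {A : Type*} [Ring A] [Algebra ℂ A] [StarRing A] [StarModule ℂ A]
    {X : Type*} [AddCommGroup X] [Module Aᵐᵒᵖ X]
    [Module.Finite Aᵐᵒᵖ X] [Module.Projective Aᵐᵒᵖ X]
    (ip : X → X → A)
    (hip_addl : ∀ x y z : X, ip (x + y) z = ip x z + ip y z)
    (hip_addr : ∀ x y z : X, ip x (y + z) = ip x y + ip x z)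
    (hip_smulr : ∀ (a : A) (x y : X), ip x (op a • y) = ip x y * a)
    (hip_star : ∀ x y : X, star (ip x y) = ip y x)
    (hip_nondeg : ∀ f : X → A, (∀ x y : X, f (x + y) = f x + f y) →
      (∀ (a : A) (x : X), f (op a • x) = f x * a) →
      ∃! z : X, ∀ y : X, f y = ip z y) :
    ∃ (n : ℕ) (x x' : Fin n → X), ∀ v : X,
      v = ∑ i, op (ip (x' i) v) • x i ∧ v = ∑ i, op (ip (x i) v) • x' i := by
  obtain ⟨n, x, φ, hφ⟩ := Module.Finite.exists_dual_basis_of_projective Aᵐᵒᵖ X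
  have ip_sum (u : X) (a : Fin n → A) (z : Fin n → X) :
      ip u (∑ i, op (a i) • z i) = ∑ i, ip u (z i) * a i := by
    simp only [← hip_smulr]
    exact map_sum (AddMonoidHom.mk' (ip u) (hip_addr u)) _ _
  choose x' hx' _ using fun i => hip_nondeg (fun v => unop (φ i v)) (by simp) (by simp)
  have reconstruct (v : X) : v = ∑ i, op (ip (x' i) v) • x i := by
    simpa only [← hx', op_unop] using hφ v
  refine ⟨n, x, x', fun v => ⟨reconstruct v, ?_⟩⟩
  refine (hip_nondeg (ip v) (hip_addr v) fun a y => hip_smulr a v y).unique (fun _ => rfl) ?_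
  intro y
  calc ip v y = ip v (∑ i, op (ip (x' i) y) • x i) := by rw [← reconstruct y]
    _ = star (ip y (∑ i, op (ip (x i) v) • x' i)) := by
      simp only [ip_sum, star_sum, star_mul, hip_star]
    _ = ip (∑ i, op (ip (x i) v) • x' i) y := hip_star _ _
end

section
/- Let (Ω, †, ⟨·,·⟩) be as in the context. For ω ∈ Ω, the right-linear vector field ♯ʳ(ω) (given by ♯ʳ(ω)(η) = ⟨ω†,η⟩) is an A-bimodule map Ω → A if and only if ω ∈ Z(Ω). Consequently ♯ʳ restricts to a bijection from the centre Z(Ω) onto the set of bilinear vector fields, and likewise ♯ˡ (given by ♯ˡ(ω)(η) = ⟨η†,ω⟩) restricts to a bijection from Z(Ω) onto the set of bilinear vector fields. -/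
open MulOpposite

/-- A bilinear vector field: an `A`-bimodule map `Ω → A`. -/
def IsBilinearVF {A : Type*} [Ring A] {Ω : Type*} [AddCommGroup Ω]
    [Module A Ω] [Module Aᵐᵒᵖ Ω] (X : Ω → A) : Prop :=
  (∀ x y : Ω, X (x + y) = X x + X y) ∧
  (∀ (a : A) (ω : Ω), X (a • ω) = a * X ω) ∧
  (∀ (a : A) (ω : Ω), X (op a • ω) = X ω * a)

/-- `♯ʳ(ω)` is a bimodule map iff `ω` is central, and the musical maps
restrict to bijections from the centre `Z(Ω)` onto the bilinear vector fields. -/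
theorem central_forms_and_bilinear_vector_fields
    {A : Type*} [Ring A] [Algebra ℂ A] [StarRing A] [StarModule ℂ A]
    {Ω : Type*} [AddCommGroup Ω] [Module A Ω] [Module Aᵐᵒᵖ Ω] [SMulCommClass A Aᵐᵒᵖ Ω]
    [Module.Finite Aᵐᵒᵖ Ω] [Module.Projective Aᵐᵒᵖ Ω]
    (dag : Ω → Ω)
    (hdag_add : ∀ x y : Ω, dag (x + y) = dag x + dag y)
    (hdag_invol : ∀ x : Ω, dag (dag x) = x)
    (hdag_bimod : ∀ (a b : A) (x : Ω), dag (a • (op b • x)) = star b • (op (star a) • dag x))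
    (ip : Ω → Ω → A)
    (hip_addl : ∀ x y z : Ω, ip (x + y) z = ip x z + ip y z)
    (hip_addr : ∀ x y z : Ω, ip x (y + z) = ip x y + ip x z)
    (hip_smulr : ∀ (a : A) (x y : Ω), ip x (op a • y) = ip x y * a)
    (hip_star : ∀ x y : Ω, star (ip x y) = ip y x)
    (hip_smull : ∀ (a : A) (x y : Ω), ip (a • x) y = ip x (star a • y))
    (hip_nondeg : ∀ f : Ω → A, (∀ x y : Ω, f (x + y) = f x + f y) →
      (∀ (a : A) (x : Ω), f (op a • x) = f x * a) →
      ∃! ω : Ω, ∀ η : Ω, f η = ip (dag ω) η) :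
    -- `♯ʳ(ω)` is a bimodule map iff `ω` is central
    (∀ ω : Ω, IsBilinearVF (fun η : Ω => ip (dag ω) η) ↔ (∀ a : A, a • ω = op a • ω)) ∧
    -- `♯ʳ` restricts to a bijection `Z(Ω) → {bilinear vector fields}`
    Set.BijOn (fun ω : Ω => (fun η : Ω => ip (dag ω) η))
      {ω : Ω | ∀ a : A, a • ω = op a • ω} {X : Ω → A | IsBilinearVF X} ∧
    -- `♯ˡ` restricts to a bijection `Z(Ω) → {bilinear vector fields}`
    Set.BijOn (fun ω : Ω => (fun η : Ω => ip (dag η) ω))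
      {ω : Ω | ∀ a : A, a • ω = op a • ω} {X : Ω → A | IsBilinearVF X} := by
  have dag_smul : ∀ (a : A) (x : Ω), dag (a • x) = op (star a) • dag x := fun a x => by
    simpa using hdag_bimod a 1 x
  have dag_op_smul : ∀ (a : A) (x : Ω), dag (op a • x) = star a • dag x := fun a x => by
    simpa using hdag_bimod 1 a x
  have sharp_op_smul : ∀ (a : A) (ω η : Ω), ip (dag (op a • ω)) η = ip (dag ω) (a • η) :=
    fun a ω η => by rw [dag_op_smul, hip_smull, star_star]
  have sharp_smul : ∀ (a : A) (ω η : Ω), ip (dag (a • ω)) η = a * ip (dag ω) η :=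
    fun a ω η => by
      rw [dag_smul, ← hip_star, hip_smulr, star_mul, star_star, hip_star]
  have sharp_inj : ∀ ω ω' : Ω, (∀ η, ip (dag ω) η = ip (dag ω') η) → ω = ω' :=
    fun ω ω' h => (hip_nondeg (fun η => ip (dag ω) η) (fun x y => hip_addr _ x y)
      (fun a x => hip_smulr a _ x)).unique (fun _ => rfl) h
  have bilinear_iff : ∀ ω : Ω,
      IsBilinearVF (fun η : Ω => ip (dag ω) η) ↔ (∀ a : A, a • ω = op a • ω) := by
    refine fun ω => ⟨fun h a => sharp_inj _ _ fun η => ?_, fun h =>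
      ⟨fun x y => hip_addr _ x y, fun a η => ?_, fun a η => hip_smulr a _ η⟩⟩
    · rw [sharp_smul, sharp_op_smul]
      exact (h.2.1 a η).symm
    · change ip (dag ω) (a • η) = a * ip (dag ω) η
      rw [← sharp_op_smul, ← h a, sharp_smul]
  have sharp_right : Set.BijOn (fun ω : Ω => (fun η : Ω => ip (dag ω) η))
      {ω : Ω | ∀ a : A, a • ω = op a • ω} {X : Ω → A | IsBilinearVF X} := by
    refine ⟨fun ω h => (bilinear_iff ω).2 h,
      fun ω _ ω' _ h => sharp_inj ω ω' (congrFun h), fun X hX => ?_⟩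
    obtain ⟨ω, hω, -⟩ := hip_nondeg X hX.1 hX.2.2
    obtain rfl : X = fun η => ip (dag ω) η := funext hω
    exact ⟨ω, (bilinear_iff ω).1 hX, rfl⟩
  have dag_central : Set.MapsTo dag {ω : Ω | ∀ a : A, a • ω = op a • ω}
      {ω : Ω | ∀ a : A, a • ω = op a • ω} := fun ω h a => by
    have := congrArg dag (h (star a))
    rw [dag_smul, dag_op_smul, star_star] at this
    exact this.symm
  have dag_bijOn : Set.BijOn dag {ω : Ω | ∀ a : A, a • ω = op a • ω}
      {ω : Ω | ∀ a : A, a • ω = op a • ω} :=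
    Set.InvOn.bijOn ⟨fun x _ => hdag_invol x, fun x _ => hdag_invol x⟩ dag_central dag_central
  have conj_bilinear : Set.MapsTo (fun (X : Ω → A) (η : Ω) => star (X (dag η)))
      {X : Ω → A | IsBilinearVF X} {X : Ω → A | IsBilinearVF X} := by
    rintro X ⟨hadd, hleft, hright⟩
    refine ⟨fun x y => ?_, fun a η => ?_, fun a η => ?_⟩
    · simp only [hdag_add, hadd, star_add]
    · simp only [dag_smul, hright, star_mul, star_star]
    · simp only [dag_op_smul, hleft, star_mul, star_star]
  have conj_conj : ∀ X : Ω → A, (fun η => star (star (X (dag (dag η))))) = X := fun X => by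
    simp only [hdag_invol, star_star]
  have conj_bijOn : Set.BijOn (fun (X : Ω → A) (η : Ω) => star (X (dag η)))
      {X : Ω → A | IsBilinearVF X} {X : Ω → A | IsBilinearVF X} :=
    Set.InvOn.bijOn ⟨fun X _ => conj_conj X, fun X _ => conj_conj X⟩ conj_bilinear conj_bilinear
  refine ⟨bilinear_iff, sharp_right,
    (conj_bijOn.comp (sharp_right.comp dag_bijOn)).congr fun ω _ => funext fun η => ?_⟩
  simp only [Function.comp_apply, hdag_invol, hip_star]
end

section
/- Let A be a unital complex *-algebra, Ω an A-bimodule, and d : A → Ω a ℂ-linear map with d(ab) = d(a)·b + a·d(b) such that every element of Ω is a finite sum Σᵢ aᵢ·d(bᵢ). Then: (1) for every ∂ ∈ D_ℂ the map φ(∂) is well defined (Σᵢ aᵢ·∂(bᵢ) depends only on Σᵢ aᵢ·d(bᵢ)) and is an A-bimodule map Ω → A; (2) φ : D_ℂ → {bilinear vector fields} is ℂ-linear and bijective, with inverse sending a bilinear vector field X to the derivation a ↦ X(d(a)). -/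
open MulOpposite

/-- Membership in `D_ℂ`: a ℂ-linear derivation `∂ : A → A` compatible with the
relations of the differential `d : A → Ω`. -/
def MemDC {A : Type*} [Ring A] [Algebra ℂ A] {Ω : Type*} [AddCommGroup Ω]
    [Module A Ω] [Module Aᵐᵒᵖ Ω] (d : A → Ω) (δ : A → A) : Prop :=
  (∀ a b : A, δ (a + b) = δ a + δ b) ∧
  (∀ (c : ℂ) (a : A), δ (c • a) = c • δ a) ∧
  (∀ a b : A, δ (a * b) = δ a * b + a * δ b) ∧
  (∀ (n : ℕ) (a b : Fin n → A), (∑ i, a i • d (b i)) = 0 → (∑ i, a i * δ (b i)) = 0)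

namespace MemDC

variable {A : Type*} [Ring A] [Algebra ℂ A] {Ω : Type*} [AddCommGroup Ω]
  [Module A Ω] [Module Aᵐᵒᵖ Ω] {d : A → Ω} {δ δ₁ δ₂ : A → A}

theorem sum_eq_of_sum_eq (h : MemDC d δ) {n m : ℕ} {a b : Fin n → A} {a' b' : Fin m → A}
    (e : ∑ i, a i • d (b i) = ∑ j, a' j • d (b' j)) :
    ∑ i, a i * δ (b i) = ∑ j, a' j * δ (b' j) := by
  have key := h.2.2.2 (n + m) (Fin.append a (-a')) (Fin.append b b')
    (by simp [Fin.sum_univ_add, e])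
  simpa [Fin.sum_univ_add, ← sub_eq_add_neg, sub_eq_zero] using key

theorem smul_add (h₁ : MemDC d δ₁) (h₂ : MemDC d δ₂) (c : ℂ) :
    MemDC d (fun a => c • δ₁ a + δ₂ a) := by
  refine ⟨fun a b => ?_, fun k a => ?_, fun a b => ?_, fun n a b e => ?_⟩
  · simp only [h₁.1, h₂.1, _root_.smul_add]
    abel
  · simp only [h₁.2.1, h₂.2.1, _root_.smul_add, smul_comm c k]
  · simp only [h₁.2.2.1, h₂.2.2.1, _root_.smul_add, mul_add, add_mul, smul_mul_assoc,
      mul_smul_comm]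
    abel
  · simp only [mul_add, mul_smul_comm, Finset.sum_add_distrib, ← Finset.smul_sum,
      h₁.2.2.2 n a b e, h₂.2.2.2 n a b e, smul_zero, add_zero]

end MemDC

namespace IsBilinearVF

variable {A : Type*} [Ring A] {Ω : Type*} [AddCommGroup Ω]
  [Module A Ω] [Module Aᵐᵒᵖ Ω] {X : Ω → A}

theorem map_sum_smul (hX : IsBilinearVF X) (d : A → Ω) {n : ℕ} (a b : Fin n → A) :
    X (∑ i, a i • d (b i)) = ∑ i, a i * X (d (b i)) := by
  simp only [← hX.2.1]
  exact map_sum (AddMonoidHom.mk' X hX.1) _ _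

theorem memDC_comp [Algebra ℂ A] (hX : IsBilinearVF X) {d : A → Ω}
    (hd_add : ∀ a b : A, d (a + b) = d a + d b)
    (hd_smulC : ∀ (c : ℂ) (a : A), d (c • a) = algebraMap ℂ A c • d a)
    (hd_leibniz : ∀ a b : A, d (a * b) = op b • d a + a • d b) :
    MemDC d (fun a => X (d a)) := by
  refine ⟨fun a b => ?_, fun c a => ?_, fun a b => ?_, fun n a b e => ?_⟩
  · simp only [hd_add, hX.1]
  · simp only [hd_smulC, hX.2.1, ← Algebra.smul_def]
  · simp only [hd_leibniz, hX.1, hX.2.1, hX.2.2]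
  · rw [← hX.map_sum_smul d a b, e]
    simpa using hX.2.1 0 0

end IsBilinearVF

/-- A map `Ω → A` given on sums `∑ i, a i • d (b i)` by a Leibniz map `δ` is a bimodule map. -/
theorem isBilinearVF_of_map_sum_smul {A : Type*} [Ring A] {Ω : Type*} [AddCommGroup Ω]
    [Module A Ω] [Module Aᵐᵒᵖ Ω] [SMulCommClass A Aᵐᵒᵖ Ω] {d : A → Ω} {δ : A → A} {X : Ω → A}
    (hd_leibniz : ∀ a b : A, d (a * b) = op b • d a + a • d b)
    (hgen : ∀ v : Ω, ∃ (n : ℕ) (a b : Fin n → A), v = ∑ i, a i • d (b i))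
    (hδ : ∀ a b : A, δ (a * b) = δ a * b + a * δ b)
    (hX : ∀ (n : ℕ) (a b : Fin n → A), X (∑ i, a i • d (b i)) = ∑ i, a i * δ (b i)) :
    IsBilinearVF X := by
  have hadd : ∀ x y : Ω, X (x + y) = X x + X y := by
    intro x y
    obtain ⟨n, a, b, rfl⟩ := hgen x
    obtain ⟨m, a', b', rfl⟩ := hgen y
    simpa [Fin.sum_univ_add, hX] using hX (n + m) (Fin.append a a') (Fin.append b b')
  have hone : ∀ a b : A, X (a • d b) = a * δ b := fun a b => by
    simpa using hX 1 (fun _ => a) (fun _ => b)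
  have hsum : ∀ (n : ℕ) (f : Fin n → Ω), X (∑ i, f i) = ∑ i, X (f i) := fun n f =>
    map_sum (AddMonoidHom.mk' X hadd) f Finset.univ
  refine ⟨hadd, fun c ω => ?_, fun c ω => ?_⟩
  · obtain ⟨n, a, b, rfl⟩ := hgen ω
    simp only [Finset.smul_sum, smul_smul, hX, Finset.mul_sum, mul_assoc]
  · obtain ⟨n, a, b, rfl⟩ := hgen ω
    rw [Finset.smul_sum, hsum, hX, Finset.sum_mul]
    refine Finset.sum_congr rfl fun i _ => ?_
    have e : op c • a i • d (b i) + (a i * b i) • d c = a i • d (b i * c) := by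
      rw [hd_leibniz, smul_add, smul_comm (a i) (op c), smul_smul]
    have e' := congrArg X e
    rw [hadd, hone, hone, hδ, mul_add, ← mul_assoc, ← mul_assoc] at e'
    exact add_right_cancel e'

/-- For a surjective derivation-generated bimodule of one-forms, each
`∂ ∈ D_ℂ` induces a well-defined bilinear vector field `φ(∂)`, and `φ` is a ℂ-linear
bijection from `D_ℂ` onto the bilinear vector fields, with inverse `X ↦ (a ↦ X (d a))`. -/
theorem phi_bijection_DC_bilinear
    {A : Type*} [Ring A] [Algebra ℂ A] [StarRing A] [StarModule ℂ A]
    {Ω : Type*} [AddCommGroup Ω] [Module A Ω] [Module Aᵐᵒᵖ Ω] [SMulCommClass A Aᵐᵒᵖ Ω]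
    (d : A → Ω)
    (hd_add : ∀ a b : A, d (a + b) = d a + d b)
    (hd_smulC : ∀ (c : ℂ) (a : A), d (c • a) = algebraMap ℂ A c • d a)
    (hd_leibniz : ∀ a b : A, d (a * b) = op b • d a + a • d b)
    (hgen : ∀ v : Ω, ∃ (n : ℕ) (a b : Fin n → A), v = ∑ i, a i • d (b i)) :
    -- (1) well-definedness: `Σ aᵢ ∂(bᵢ)` depends only on `Σ aᵢ d(bᵢ)`
    (∀ δ : A → A, MemDC d δ → ∀ (n m : ℕ) (a b : Fin n → A) (a' b' : Fin m → A),
      (∑ i, a i • d (b i)) = (∑ j, a' j • d (b' j)) →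
      (∑ i, a i * δ (b i)) = (∑ j, a' j * δ (b' j))) ∧
    -- and the corresponding map `φ`:
    ∃ Φ : (A → A) → (Ω → A),
      -- (1) `φ(∂)` is an `A`-bimodule map with `φ(∂)(a · d b) = a · ∂ b`
      (∀ δ : A → A, MemDC d δ →
        IsBilinearVF (Φ δ) ∧ ∀ a b : A, Φ δ (a • d b) = a * δ b) ∧
      -- (2) `φ` is ℂ-linear ...
      (∀ δ₁ δ₂ : A → A, MemDC d δ₁ → MemDC d δ₂ → ∀ c : ℂ,
        MemDC d (fun a => c • δ₁ a + δ₂ a) ∧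
        ∀ ω : Ω, Φ (fun a => c • δ₁ a + δ₂ a) ω = c • Φ δ₁ ω + Φ δ₂ ω) ∧
      -- ... injective ...
      (∀ δ₁ δ₂ : A → A, MemDC d δ₁ → MemDC d δ₂ →
        (∀ ω : Ω, Φ δ₁ ω = Φ δ₂ ω) → ∀ a : A, δ₁ a = δ₂ a) ∧
      -- ... and surjective onto the bilinear vector fields, with inverse `X ↦ (a ↦ X (d a))`
      (∀ X : Ω → A, IsBilinearVF X →
        MemDC d (fun a => X (d a)) ∧ ∀ ω : Ω, Φ (fun a => X (d a)) ω = X ω) ∧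
      (∀ δ : A → A, MemDC d δ → ∀ a : A, Φ δ (d a) = δ a) := by
  refine ⟨fun δ h n m a b a' b' e => h.sum_eq_of_sum_eq e, ?_⟩
  choose N a b hab using hgen
  have hgen : ∀ v : Ω, ∃ (n : ℕ) (a b : Fin n → A), v = ∑ i, a i • d (b i) :=
    fun v => ⟨N v, a v, b v, hab v⟩
  let Φ : (A → A) → Ω → A := fun δ ω => ∑ i, a ω i * δ (b ω i)
  have hΦ_sum : ∀ δ, MemDC d δ → ∀ (n : ℕ) (a b : Fin n → A),
      Φ δ (∑ i, a i • d (b i)) = ∑ i, a i * δ (b i) :=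
    fun δ h n a b => h.sum_eq_of_sum_eq (hab _).symm
  have hΦ_smul : ∀ δ, MemDC d δ → ∀ a b : A, Φ δ (a • d b) = a * δ b := fun δ h a b => by
    simpa using hΦ_sum δ h 1 (fun _ => a) (fun _ => b)
  have hΦ_d : ∀ δ, MemDC d δ → ∀ a : A, Φ δ (d a) = δ a := fun δ h a => by
    simpa using hΦ_smul δ h 1 a
  refine ⟨Φ, fun δ h => ⟨isBilinearVF_of_map_sum_smul hd_leibniz hgen h.2.2.1 (hΦ_sum δ h),
    hΦ_smul δ h⟩, fun δ₁ δ₂ h₁ h₂ c => ⟨h₁.smul_add h₂ c, fun ω => ?_⟩,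
    fun δ₁ δ₂ h₁ h₂ e a => ?_, fun X hX => ⟨hX.memDC_comp hd_add hd_smulC hd_leibniz,
    fun ω => ?_⟩, hΦ_d⟩
  · simp only [Φ, mul_add, mul_smul_comm, Finset.sum_add_distrib, Finset.smul_sum]
  · rw [← hΦ_d δ₁ h₁, ← hΦ_d δ₂ h₂, e]
  · exact (hX.map_sum_smul d (a ω) (b ω)).symm.trans (congrArg X (hab ω).symm)
end

section
/- Let A be a unital complex *-algebra, Ω an A-bimodule with an antilinear involution † satisfying (a·ω·b)† = b*·ω†·a*, and d : A → Ω a ℂ-linear map with d(ab) = d(a)·b + a·d(b) and d(a*) = -d(a)†, such that every element of Ω is a finite sum Σᵢ aᵢ·d(bᵢ). Then for ∂ ∈ D_ℂ, the derivation ∂ is Hermitian (∂(a*) = ∂(a)* for all a) if and only if the bilinear vector field φ(∂) is real, i.e. φ(∂)(ω†)* = -φ(∂)(ω) for all ω ∈ Ω. Consequently φ restricts to a real-linear bijection from D onto the set of real bilinear vector fields. -/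
open MulOpposite

/-- A bilinear vector field as an additive homomorphism. -/
def IsBilinearVF.toAddMonoidHom {A : Type*} [Ring A] {Ω : Type*} [AddCommGroup Ω]
    [Module A Ω] [Module Aᵐᵒᵖ Ω] {X : Ω → A} (hX : IsBilinearVF X) : Ω →+ A :=
  AddMonoidHom.mk' X hX.1

theorem IsBilinearVF.map_neg {A : Type*} [Ring A] {Ω : Type*} [AddCommGroup Ω]
    [Module A Ω] [Module Aᵐᵒᵖ Ω] {X : Ω → A} (hX : IsBilinearVF X) (x : Ω) :
    X (-x) = -X x :=
  _root_.map_neg hX.toAddMonoidHom x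

theorem IsBilinearVF.map_sum_smul_s7 {A : Type*} [Ring A] {Ω : Type*} [AddCommGroup Ω]
    [Module A Ω] [Module Aᵐᵒᵖ Ω] {X : Ω → A} (hX : IsBilinearVF X) {ι : Type*}
    (s : Finset ι) (a : ι → A) (x : ι → Ω) :
    X (∑ i ∈ s, a i • x i) = ∑ i ∈ s, a i * X (x i) :=
  (map_sum hX.toAddMonoidHom _ s).trans (Finset.sum_congr rfl fun i _ => hX.2.1 (a i) (x i))

/-- A bilinear vector field composed with a ℂ-linear differential lies in `D_ℂ`. -/
theorem IsBilinearVF.memDC_comp_s7 {A : Type*} [Ring A] [Algebra ℂ A] {Ω : Type*} [AddCommGroup Ω]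
    [Module A Ω] [Module Aᵐᵒᵖ Ω] {X : Ω → A} (hX : IsBilinearVF X) {d : A → Ω}
    (hd_add : ∀ a b : A, d (a + b) = d a + d b)
    (hd_smulC : ∀ (c : ℂ) (a : A), d (c • a) = algebraMap ℂ A c • d a)
    (hd_leibniz : ∀ a b : A, d (a * b) = op b • d a + a • d b) :
    MemDC d (fun a => X (d a)) := by
  refine ⟨fun a b => ?_, fun c a => ?_, fun a b => ?_, fun n a b h => ?_⟩
  · simp only [hd_add, hX.1]
  · simp only [hd_smulC, hX.2.1, ← Algebra.smul_def]
  · simp only [hd_leibniz, hX.1, hX.2.1, hX.2.2]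
  · rw [← hX.map_sum_smul_s7, h]
    exact map_zero hX.toAddMonoidHom

/-- A bilinear vector field `X` is real iff the derivation `X ∘ d` is Hermitian. -/
theorem IsBilinearVF.hermitian_comp_iff_real {A : Type*} [Ring A] [StarRing A]
    {Ω : Type*} [AddCommGroup Ω] [Module A Ω] [Module Aᵐᵒᵖ Ω] {X : Ω → A} (hX : IsBilinearVF X)
    {dag : Ω → Ω} (hdag_add : ∀ x y : Ω, dag (x + y) = dag x + dag y)
    (hdag_bimod : ∀ (a b : A) (x : Ω), dag (a • (op b • x)) = star b • (op (star a) • dag x))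
    {d : A → Ω} (hd_star : ∀ a : A, d (star a) = - dag (d a))
    (hgen : ∀ v : Ω, ∃ (n : ℕ) (a b : Fin n → A), v = ∑ i, a i • d (b i)) :
    (∀ a : A, X (d (star a)) = star (X (d a))) ↔ (∀ ω : Ω, star (X (dag ω)) = - X ω) := by
  constructor
  · intro h ω
    obtain ⟨n, a, b, rfl⟩ := hgen ω
    have hdag (a b : A) : star (X (dag (a • d b))) = -(a * X (d b)) := by
      have h₁ : dag (a • d b) = op (star a) • dag (d b) := by
        simpa using hdag_bimod a 1 (d b)
      have h₂ : dag (d b) = -d (star b) := by rw [hd_star, neg_neg]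
      rw [h₁, hX.2.2, h₂, hX.map_neg, h]
      simp
    have hsum : dag (∑ i, a i • d (b i)) = ∑ i, dag (a i • d (b i)) :=
      map_sum (AddMonoidHom.mk' dag hdag_add) _ _
    have hXsum : X (∑ i, dag (a i • d (b i))) = ∑ i, X (dag (a i • d (b i))) :=
      map_sum hX.toAddMonoidHom _ _
    rw [hsum, hXsum, star_sum, hX.map_sum_smul_s7, ← Finset.sum_neg_distrib]
    exact Finset.sum_congr rfl fun i _ => hdag (a i) (b i)
  · intro h a
    rw [hd_star, hX.map_neg, ← star_star (X (dag (d a))), h, star_neg, neg_neg]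

/-- For `∂ ∈ D_ℂ`, the derivation `∂` is Hermitian iff the bilinear
vector field `φ(∂)` is real; consequently `φ` restricts to a real-linear bijection from
`D` onto the real bilinear vector fields. -/
theorem hermitian_iff_real
    {A : Type*} [Ring A] [Algebra ℂ A] [StarRing A] [StarModule ℂ A]
    {Ω : Type*} [AddCommGroup Ω] [Module A Ω] [Module Aᵐᵒᵖ Ω] [SMulCommClass A Aᵐᵒᵖ Ω]
    (dag : Ω → Ω)
    (hdag_add : ∀ x y : Ω, dag (x + y) = dag x + dag y)
    (hdag_invol : ∀ x : Ω, dag (dag x) = x)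
    (hdag_bimod : ∀ (a b : A) (x : Ω), dag (a • (op b • x)) = star b • (op (star a) • dag x))
    (d : A → Ω)
    (hd_add : ∀ a b : A, d (a + b) = d a + d b)
    (hd_smulC : ∀ (c : ℂ) (a : A), d (c • a) = algebraMap ℂ A c • d a)
    (hd_leibniz : ∀ a b : A, d (a * b) = op b • d a + a • d b)
    (hd_star : ∀ a : A, d (star a) = - dag (d a))
    (hgen : ∀ v : Ω, ∃ (n : ℕ) (a b : Fin n → A), v = ∑ i, a i • d (b i)) :
    -- `∂` is Hermitian iff `φ(∂)` is real
    (∀ δ : A → A, MemDC d δ → ∀ X : Ω → A, IsBilinearVF X →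
      (∀ a b : A, X (a • d b) = a * δ b) →
      ((∀ a : A, δ (star a) = star (δ a)) ↔ (∀ ω : Ω, star (X (dag ω)) = - X ω))) ∧
    -- every real bilinear vector field arises from a Hermitian derivation in `D_ℂ`
    (∀ X : Ω → A, IsBilinearVF X → (∀ ω : Ω, star (X (dag ω)) = - X ω) →
      MemDC d (fun a => X (d a)) ∧ (∀ a : A, X (d (star a)) = star (X (d a)))) ∧
    -- the restriction is injective
    (∀ δ₁ δ₂ : A → A, MemDC d δ₁ → MemDC d δ₂ → ∀ X : Ω → A, IsBilinearVF X →
      (∀ a b : A, X (a • d b) = a * δ₁ b) → (∀ a b : A, X (a • d b) = a * δ₂ b) →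
      ∀ a : A, δ₁ a = δ₂ a) := by
  have apply_d {δ : A → A} {X : Ω → A} (h : ∀ a b : A, X (a • d b) = a * δ b) (b : A) :
      X (d b) = δ b := by simpa using h 1 b
  refine ⟨fun δ _ X hX h => ?_, fun X hX hreal => ?_, fun δ₁ δ₂ _ _ X _ h₁ h₂ a => ?_⟩
  · simpa only [apply_d h] using
      hX.hermitian_comp_iff_real hdag_add hdag_bimod hd_star hgen
  · exact ⟨hX.memDC_comp_s7 hd_add hd_smulC hd_leibniz,
      (hX.hermitian_comp_iff_real hdag_add hdag_bimod hd_star hgen).2 hreal⟩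
  · rw [← apply_d h₁, apply_d h₂]
end

section
/- Let A be a unital complex *-algebra and Ω an A-bimodule with an inner product ⟨·,·⟩ : Ω × Ω → A, additive in each argument, satisfying ⟨ω, η·a⟩ = ⟨ω,η⟩·a, ⟨ω,η⟩* = ⟨η,ω⟩, and ⟨a·ω, η⟩ = ⟨ω, a*·η⟩. Then for all central elements ω, ρ, η, τ ∈ Z(Ω): (1) ⟨ρ,η⟩ lies in the centre of A; (2) ⟨ω, ⟨ρ,η⟩·τ⟩ = ⟨ω,τ⟩·⟨ρ,η⟩ = ⟨ρ, ⟨ω,τ⟩·η⟩. (This identity expresses that the canonical braiding on two-tensors over a centred bimodule is self-adjoint, so that Ψ = (1+σ)/2 is an orthogonal projection.) -/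
open MulOpposite

/-- The inner product of two central elements of an inner-product bimodule is central. -/
theorem ip_central_of_central {A Ω : Type*} [Ring A] [StarRing A]
    [SMul A Ω] [SMul Aᵐᵒᵖ Ω] {ip : Ω → Ω → A}
    (hip_smulr : ∀ (a : A) (x y : Ω), ip x (op a • y) = ip x y * a)
    (hip_star : ∀ x y : Ω, star (ip x y) = ip y x)
    (hip_smull : ∀ (a : A) (x y : Ω), ip (a • x) y = ip x (star a • y))
    {ρ η : Ω} (hρ : ∀ a : A, a • ρ = op a • ρ) (hη : ∀ a : A, a • η = op a • η) (a : A) :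
    a * ip ρ η = ip ρ η * a :=
  calc a * ip ρ η = star (ip η (op (star a) • ρ)) := by
        rw [hip_smulr, star_mul, star_star, hip_star]
    _ = ip ρ (a • η) := by rw [← hρ, hip_star, hip_smull, star_star]
    _ = ip ρ η * a := by rw [hη, hip_smulr]

/-- For central elements of an inner-product bimodule, the inner product
is central in `A` and satisfies the exchange identity making the canonical braiding
self-adjoint. -/
theorem braiding_selfadjoint_identities
    {A : Type*} [Ring A] [Algebra ℂ A] [StarRing A] [StarModule ℂ A]
    {Ω : Type*} [AddCommGroup Ω] [Module A Ω] [Module Aᵐᵒᵖ Ω] [SMulCommClass A Aᵐᵒᵖ Ω]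
    (ip : Ω → Ω → A)
    (hip_addl : ∀ x y z : Ω, ip (x + y) z = ip x z + ip y z)
    (hip_addr : ∀ x y z : Ω, ip x (y + z) = ip x y + ip x z)
    (hip_smulr : ∀ (a : A) (x y : Ω), ip x (op a • y) = ip x y * a)
    (hip_star : ∀ x y : Ω, star (ip x y) = ip y x)
    (hip_smull : ∀ (a : A) (x y : Ω), ip (a • x) y = ip x (star a • y)) :
    ∀ ω ρ η τ : Ω,
      (∀ a : A, a • ω = op a • ω) → (∀ a : A, a • ρ = op a • ρ) →
      (∀ a : A, a • η = op a • η) → (∀ a : A, a • τ = op a • τ) →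
      -- (1) `⟨ρ,η⟩` is central in `A`
      (∀ a : A, a * ip ρ η = ip ρ η * a) ∧
      -- (2) the exchange identities
      ip ω (ip ρ η • τ) = ip ω τ * ip ρ η ∧
      ip ω τ * ip ρ η = ip ρ (ip ω τ • η) := by
  intro ω ρ η τ _ hρ hη hτ
  have hc := ip_central_of_central hip_smulr hip_star hip_smull hρ hη
  refine ⟨hc, ?_, ?_⟩
  · rw [hτ, hip_smulr]
  · rw [hη, hip_smulr, hc]
end

section
/- Let (Ω, †, ⟨·,·⟩) be as in the context, with Ω centred and the quantum metric symmetric on central forms. For a bilinear vector field X let ♭(X) ∈ Z(Ω) denote the unique central element with ♯ˡ(♭(X)) = X (which exists since ♯ˡ restricts to a bijection Z(Ω) → {bilinear vector fields}). Then for all bilinear vector fields X, Y: (1) ♭(X†) = (♭(X))†; (2) the inner product ⟨X,Y⟩ := ⟨♭(X), ♭(Y)⟩ satisfies ⟨X,Y⟩ = ⟨Y†,X†⟩; (3) if X and Y are real (X† = -X, Y† = -Y), then ⟨X,Y⟩* = ⟨X,Y⟩. -/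
open MulOpposite

/-- On a centred Hermitian differential calculus: (1) `♭(X†) = ♭(X)†`;
(2) `⟨X,Y⟩ = ⟨Y†,X†⟩`; (3) for real bilinear vector fields `⟨X,Y⟩* = ⟨X,Y⟩`.
Here `♭(X)` is encoded by any central `ωX` with `♯ˡ(ωX) = X`, i.e. `⟨η†,ωX⟩ = X η`. -/
theorem inner_product_symmetry_on_bilinear_vector_fields
    {A : Type*} [Ring A] [Algebra ℂ A] [StarRing A] [StarModule ℂ A]
    {Ω : Type*} [AddCommGroup Ω] [Module A Ω] [Module Aᵐᵒᵖ Ω] [SMulCommClass A Aᵐᵒᵖ Ω]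
    [Module.Finite Aᵐᵒᵖ Ω] [Module.Projective Aᵐᵒᵖ Ω]
    (dag : Ω → Ω)
    (hdag_add : ∀ x y : Ω, dag (x + y) = dag x + dag y)
    (hdag_invol : ∀ x : Ω, dag (dag x) = x)
    (hdag_bimod : ∀ (a b : A) (x : Ω), dag (a • (op b • x)) = star b • (op (star a) • dag x))
    (ip : Ω → Ω → A)
    (hip_addl : ∀ x y z : Ω, ip (x + y) z = ip x z + ip y z)
    (hip_addr : ∀ x y z : Ω, ip x (y + z) = ip x y + ip x z)
    (hip_smulr : ∀ (a : A) (x y : Ω), ip x (op a • y) = ip x y * a)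
    (hip_star : ∀ x y : Ω, star (ip x y) = ip y x)
    (hip_smull : ∀ (a : A) (x y : Ω), ip (a • x) y = ip x (star a • y))
    (hip_nondeg : ∀ f : Ω → A, (∀ x y : Ω, f (x + y) = f x + f y) →
      (∀ (a : A) (x : Ω), f (op a • x) = f x * a) →
      ∃! ω : Ω, ∀ η : Ω, f η = ip (dag ω) η)
    -- `Ω` is centred
    (hcentred : ∀ v : Ω, ∃ (n : ℕ) (ω : Fin n → Ω) (c : Fin n → A),
      (∀ i, ∀ a : A, a • ω i = op a • ω i) ∧ v = ∑ i, op (c i) • ω i)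
    -- the quantum metric is symmetric on central forms
    (hsymm : ∀ ω η : Ω, (∀ a : A, a • ω = op a • ω) → (∀ a : A, a • η = op a • η) →
      ip (dag ω) η = ip (dag η) ω) :
    ∀ X Y : Ω → A, IsBilinearVF X → IsBilinearVF Y →
    ∀ ωX ωY : Ω,
      (∀ a : A, a • ωX = op a • ωX) → (∀ a : A, a • ωY = op a • ωY) →
      (∀ η : Ω, ip (dag η) ωX = X η) → (∀ η : Ω, ip (dag η) ωY = Y η) →
      -- (1) `♭(X†) = (♭X)†`: `dag ωX` is central and represents `X†`
      ((∀ a : A, a • dag ωX = op a • dag ωX) ∧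
        (∀ η : Ω, ip (dag η) (dag ωX) = star (X (dag η)))) ∧
      -- (2) `⟨X,Y⟩ = ⟨Y†,X†⟩`
      ip ωX ωY = ip (dag ωY) (dag ωX) ∧
      -- (3) if `X`,`Y` are real then `⟨X,Y⟩` is self-adjoint
      ((∀ ω : Ω, star (X (dag ω)) = - X ω) → (∀ ω : Ω, star (Y (dag ω)) = - Y ω) →
        star (ip ωX ωY) = ip ωX ωY) := by
  intro X Y _ _ ωX ωY hX hY hωX hωY
  have dag_left (a : A) (x : Ω) : dag (a • x) = op (star a) • dag x := by
    simpa using hdag_bimod a 1 x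
  have dag_right (a : A) (x : Ω) : dag (op a • x) = star a • dag x := by
    simpa using hdag_bimod 1 a x
  have dag_central (ω : Ω) (hω : ∀ a : A, a • ω = op a • ω) (a : A) :
      a • dag ω = op a • dag ω := by
    have h := congrArg dag (hω (star a))
    rw [dag_left, dag_right, star_star] at h
    exact h.symm
  have dag_zero : dag 0 = 0 := by simpa using hdag_add 0 0
  have ip_zero_left (y : Ω) : ip 0 y = 0 := by simpa using hip_addl 0 0 y
  have ip_zero_right (x : Ω) : ip x 0 = 0 := by simpa using hip_addr x 0 0
  -- symmetry of the metric extends to one central and one arbitrary form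
  have symm_central (ω : Ω) (hω : ∀ a : A, a • ω = op a • ω) (η : Ω) :
      ip (dag η) (dag ω) = ip ω η := by
    obtain ⟨n, ζ, c, hζ, rfl⟩ := hcentred η
    refine Finset.sum_induction (fun i => op (c i) • ζ i)
      (fun η => ip (dag η) (dag ω) = ip ω η) ?_ ?_ ?_
    · intro x y hx hy
      rw [hdag_add, hip_addl, hip_addr, hx, hy]
    · rw [dag_zero, ip_zero_left, ip_zero_right]
    · intro i _
      rw [dag_right, hip_smull, star_star, dag_central ω hω, hip_smulr, hip_smulr,
        hsymm _ _ (hζ i) (dag_central ω hω), hdag_invol]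
  have flat_dag (Z : Ω → A) (ω : Ω) (hω : ∀ a : A, a • ω = op a • ω)
      (hZ : ∀ η : Ω, ip (dag η) ω = Z η) (η : Ω) :
      ip (dag η) (dag ω) = star (Z (dag η)) := by
    rw [symm_central ω hω, ← hZ, hdag_invol, hip_star]
  refine ⟨⟨dag_central ωX hX, flat_dag X ωX hX hωX⟩, (symm_central ωX hX ωY).symm, ?_⟩
  intro hXreal hYreal
  have hXY : ip ωY (dag ωX) = -ip ωY ωX := by
    have h := flat_dag X ωX hX hωX (dag ωY)
    rwa [hXreal, ← hωX, hdag_invol] at h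
  calc
    star (ip ωX ωY) = ip (dag ωX) (dag ωY) := by rw [hip_star, symm_central ωY hY]
    _ = -ip (dag ωX) ωY := by rw [flat_dag Y ωY hY hωY, hYreal, hωY]
    _ = ip ωX ωY := by rw [← hip_star, hXY, star_neg, neg_neg, hip_star]
end

section
/- Let (Ω, †, ⟨·,·⟩) be as in the context, with Ω centred. Then the bilinear vector fields generate the left-linear vector fields as a right A-module: every left A-module map Y : Ω → A is a finite sum Y = Σᵢ Xᵢ·aᵢ with Xᵢ bilinear vector fields and aᵢ ∈ A (where (X·a)(ω) = X(ω)·a). Symmetrically, every right A-module map Ω → A is a finite sum Σᵢ aᵢ·Xᵢ with Xᵢ bilinear. -/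
open MulOpposite

/-- Conjugating a bilinear vector field by the involutions of `Ω` and `A` gives a bilinear
vector field. -/
theorem IsBilinearVF.star_comp {A : Type*} [Ring A] [StarRing A]
    {Ω : Type*} [AddCommGroup Ω] [Module A Ω] [Module Aᵐᵒᵖ Ω] {X : Ω → A} (hX : IsBilinearVF X)
    {dag : Ω → Ω} (hadd : ∀ x y : Ω, dag (x + y) = dag x + dag y)
    (hleft : ∀ (a : A) (x : Ω), dag (a • x) = op (star a) • dag x)
    (hright : ∀ (a : A) (x : Ω), dag (op a • x) = star a • dag x) :
    IsBilinearVF fun ω => star (X (dag ω)) := by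
  obtain ⟨hXadd, hXleft, hXright⟩ := hX
  refine ⟨fun x y => ?_, fun a x => ?_, fun a x => ?_⟩
  · simp only [hadd, hXadd, star_add]
  · simp only [hleft, hXright, star_mul, star_star]
  · simp only [hright, hXleft, star_mul, star_star]

/-- Pairing with a central element is a bilinear vector field. -/
theorem isBilinearVF_of_central {A : Type*} [Ring A] [StarRing A]
    {Ω : Type*} [AddCommGroup Ω] [Module A Ω] [Module Aᵐᵒᵖ Ω] {ip : Ω → Ω → A}
    (hip_addr : ∀ x y z : Ω, ip x (y + z) = ip x y + ip x z)
    (hip_smulr : ∀ (a : A) (x y : Ω), ip x (op a • y) = ip x y * a)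
    (hip_star : ∀ x y : Ω, star (ip x y) = ip y x)
    (hip_smull : ∀ (a : A) (x y : Ω), ip (a • x) y = ip x (star a • y))
    {ω : Ω} (hω : ∀ a : A, a • ω = op a • ω) :
    IsBilinearVF (ip ω) := by
  refine ⟨hip_addr ω, fun a x => ?_, fun a x => hip_smulr a ω x⟩
  calc ip ω (a • x) = ip (star a • ω) x := by rw [hip_smull, star_star]
    _ = star (ip x (op (star a) • ω)) := by rw [hω, hip_star]
    _ = a * ip ω x := by rw [hip_smulr, star_mul, star_star, hip_star]

/-- If `Ω` is centred, the bilinear vector fields generate the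
left-linear vector fields as a right `A`-module, and the right-linear vector fields
as a left `A`-module. -/
theorem bilinear_fields_generate
    {A : Type*} [Ring A] [Algebra ℂ A] [StarRing A] [StarModule ℂ A]
    {Ω : Type*} [AddCommGroup Ω] [Module A Ω] [Module Aᵐᵒᵖ Ω] [SMulCommClass A Aᵐᵒᵖ Ω]
    [Module.Finite Aᵐᵒᵖ Ω] [Module.Projective Aᵐᵒᵖ Ω]
    (dag : Ω → Ω)
    (hdag_add : ∀ x y : Ω, dag (x + y) = dag x + dag y)
    (hdag_invol : ∀ x : Ω, dag (dag x) = x)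
    (hdag_bimod : ∀ (a b : A) (x : Ω), dag (a • (op b • x)) = star b • (op (star a) • dag x))
    (ip : Ω → Ω → A)
    (hip_addl : ∀ x y z : Ω, ip (x + y) z = ip x z + ip y z)
    (hip_addr : ∀ x y z : Ω, ip x (y + z) = ip x y + ip x z)
    (hip_smulr : ∀ (a : A) (x y : Ω), ip x (op a • y) = ip x y * a)
    (hip_star : ∀ x y : Ω, star (ip x y) = ip y x)
    (hip_smull : ∀ (a : A) (x y : Ω), ip (a • x) y = ip x (star a • y))
    (hip_nondeg : ∀ f : Ω → A, (∀ x y : Ω, f (x + y) = f x + f y) →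
      (∀ (a : A) (x : Ω), f (op a • x) = f x * a) →
      ∃! ω : Ω, ∀ η : Ω, f η = ip (dag ω) η)
    -- `Ω` is centred
    (hcentred : ∀ v : Ω, ∃ (n : ℕ) (ω : Fin n → Ω) (c : Fin n → A),
      (∀ i, ∀ a : A, a • ω i = op a • ω i) ∧ v = ∑ i, op (c i) • ω i) :
    -- every left-linear vector field is a finite right combination of bilinear fields
    (∀ Y : Ω → A, (∀ x y : Ω, Y (x + y) = Y x + Y y) →
      (∀ (a : A) (ω : Ω), Y (a • ω) = a * Y ω) →
      ∃ (n : ℕ) (X : Fin n → (Ω → A)) (c : Fin n → A),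
        (∀ i, IsBilinearVF (X i)) ∧ ∀ ω : Ω, Y ω = ∑ i, X i ω * c i) ∧
    -- every right-linear vector field is a finite left combination of bilinear fields
    (∀ f : Ω → A, (∀ x y : Ω, f (x + y) = f x + f y) →
      (∀ (a : A) (ω : Ω), f (op a • ω) = f ω * a) →
      ∃ (n : ℕ) (X : Fin n → (Ω → A)) (c : Fin n → A),
        (∀ i, IsBilinearVF (X i)) ∧ ∀ ω : Ω, f ω = ∑ i, c i * X i ω) := by
  have hdag_left (a : A) (x : Ω) : dag (a • x) = op (star a) • dag x := by
    simpa using hdag_bimod a 1 x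
  have hdag_right (a : A) (x : Ω) : dag (op a • x) = star a • dag x := by
    simpa using hdag_bimod 1 a x
  have hright (f : Ω → A) (hf_add : ∀ x y : Ω, f (x + y) = f x + f y)
      (hf_smul : ∀ (a : A) (ω : Ω), f (op a • ω) = f ω * a) :
      ∃ (n : ℕ) (X : Fin n → (Ω → A)) (c : Fin n → A),
        (∀ i, IsBilinearVF (X i)) ∧ ∀ ω : Ω, f ω = ∑ i, c i * X i ω := by
    obtain ⟨v, hv, -⟩ := hip_nondeg f hf_add hf_smul
    obtain ⟨n, ω, c, hω, rfl⟩ := hcentred v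
    have hX (i : Fin n) : IsBilinearVF (ip (dag (ω i))) := by
      refine isBilinearVF_of_central hip_addr hip_smulr hip_star hip_smull fun a => ?_
      have h := congrArg dag (hω i (star a))
      rw [hdag_left, hdag_right, star_star] at h
      exact h.symm
    refine ⟨n, fun i => ip (dag (ω i)), c, hX, fun η => ?_⟩
    let pairing : Ω →+ A := AddMonoidHom.mk' (fun x => ip (dag x) η) fun x y => by
      rw [hdag_add, hip_addl]
    calc f η = pairing (∑ i, op (c i) • ω i) := hv η
      _ = ∑ i, pairing (op (c i) • ω i) := map_sum _ _ _
      _ = ∑ i, c i * ip (dag (ω i)) η := Finset.sum_congr rfl fun i _ => by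
        change ip (dag (op (c i) • ω i)) η = _
        rw [hdag_right, hip_smull, star_star, (hX i).2.1]
  refine ⟨fun Y hY_add hY_smul => ?_, hright⟩
  obtain ⟨n, X, c, hX, hsum⟩ := hright (fun ω => star (Y (dag ω)))
    (fun x y => by rw [hdag_add, hY_add, star_add])
    (fun a ω => by rw [hdag_right, hY_smul, star_mul, star_star])
  refine ⟨n, fun i ω => star (X i (dag ω)), fun i => star (c i),
    fun i => (hX i).star_comp hdag_add hdag_left hdag_right, fun ω => ?_⟩
  have h := congrArg star (hsum (dag ω))
  simpa only [hdag_invol, star_star, star_sum, star_mul] using h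
end

section
/- Let (Ω, d, †, ⟨·,·⟩) be a centred Hermitian differential calculus as in the context. Then: (1) φ(D) generates ←X(A) as a right A-module, i.e. every left-linear vector field Y is a finite sum Y = Σᵢ φ(∂ᵢ)·aᵢ with ∂ᵢ ∈ D and aᵢ ∈ A; (2) for all ∂₁,∂₂ ∈ D, the inner product ⟨φ(∂₁), φ(∂₂)⟩ := ⟨♭ˡ(φ(∂₁)), ♭ˡ(φ(∂₂))⟩ satisfies ⟨φ(∂₁), φ(∂₂)⟩* = ⟨φ(∂₁), φ(∂₂)⟩. That is, (←X(A), ⟨·,·⟩, (D,φ)) is a right real metric calculus. -/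
open MulOpposite

/-- A left-linear vector field: a left `A`-module map `Ω → A`. -/
def IsLeftLinVF {A : Type*} [Ring A] {Ω : Type*} [AddCommGroup Ω]
    [Module A Ω] (Y : Ω → A) : Prop :=
  (∀ x y : Ω, Y (x + y) = Y x + Y y) ∧ (∀ (a : A) (ω : Ω), Y (a • ω) = a * Y ω)

/-- An element of a bimodule is central if both actions agree on it. -/
def IsCentralForm (A : Type*) [Ring A] {Ω : Type*} [AddCommGroup Ω]
    [Module A Ω] [Module Aᵐᵒᵖ Ω] (ω : Ω) : Prop :=
  ∀ a : A, a • ω = op a • ω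

/-- A bimodule with an involution `dag` and a strongly non-degenerate Hermitian inner product `ip`,
spanned by central elements on which `ip` is symmetric. -/
structure IsCentredHermitian {A : Type*} [Ring A] [StarRing A]
    {Ω : Type*} [AddCommGroup Ω] [Module A Ω] [Module Aᵐᵒᵖ Ω]
    (dag : Ω → Ω) (ip : Ω → Ω → A) : Prop where
  dag_add : ∀ x y : Ω, dag (x + y) = dag x + dag y
  dag_dag : ∀ x : Ω, dag (dag x) = x
  dag_bimod : ∀ (a b : A) (x : Ω), dag (a • (op b • x)) = star b • (op (star a) • dag x)
  add_left : ∀ x y z : Ω, ip (x + y) z = ip x z + ip y z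
  add_right : ∀ x y z : Ω, ip x (y + z) = ip x y + ip x z
  smul_right : ∀ (a : A) (x y : Ω), ip x (op a • y) = ip x y * a
  star_ip : ∀ x y : Ω, star (ip x y) = ip y x
  smul_left : ∀ (a : A) (x y : Ω), ip (a • x) y = ip x (star a • y)
  nondeg : ∀ f : Ω → A, (∀ x y : Ω, f (x + y) = f x + f y) →
    (∀ (a : A) (x : Ω), f (op a • x) = f x * a) → ∃! ω : Ω, ∀ η : Ω, f η = ip (dag ω) η
  centred : ∀ v : Ω, ∃ (n : ℕ) (ω : Fin n → Ω) (c : Fin n → A),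
    (∀ i, IsCentralForm A (ω i)) ∧ v = ∑ i, op (c i) • ω i
  symm : ∀ ω η : Ω, IsCentralForm A ω → IsCentralForm A η → ip (dag ω) η = ip (dag η) ω

namespace IsCentredHermitian

variable {A : Type*} [Ring A] [StarRing A] {Ω : Type*} [AddCommGroup Ω]
  [Module A Ω] [Module Aᵐᵒᵖ Ω] {dag : Ω → Ω} {ip : Ω → Ω → A}

theorem dag_smul (h : IsCentredHermitian dag ip) (a : A) (x : Ω) :
    dag (a • x) = op (star a) • dag x := by
  simpa using h.dag_bimod a 1 x

theorem dag_op_smul (h : IsCentredHermitian dag ip) (a : A) (x : Ω) :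
    dag (op a • x) = star a • dag x := by
  simpa using h.dag_bimod 1 a x

theorem dag_neg (h : IsCentredHermitian dag ip) (x : Ω) : dag (-x) = -dag x :=
  map_neg (AddMonoidHom.mk' dag h.dag_add) x

theorem dag_sub (h : IsCentredHermitian dag ip) (x y : Ω) : dag (x - y) = dag x - dag y :=
  map_sub (AddMonoidHom.mk' dag h.dag_add) x y

theorem neg_left (h : IsCentredHermitian dag ip) (x y : Ω) : ip (-x) y = -ip x y :=
  map_neg (AddMonoidHom.mk' (ip · y) fun a b => h.add_left a b y) x

theorem sub_right (h : IsCentredHermitian dag ip) (x y z : Ω) :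
    ip x (y - z) = ip x y - ip x z :=
  map_sub (AddMonoidHom.mk' (ip x) (h.add_right x)) y z

theorem sum_right (h : IsCentredHermitian dag ip) {ι : Type*} (s : Finset ι) (x : Ω) (f : ι → Ω) :
    ip x (∑ i ∈ s, f i) = ∑ i ∈ s, ip x (f i) :=
  map_sum (AddMonoidHom.mk' (ip x) (h.add_right x)) f s

theorem op_smul_left (h : IsCentredHermitian dag ip) (a : A) (x y : Ω) :
    ip (op a • x) y = star a * ip x y := by
  rw [← h.star_ip, h.smul_right, star_mul, h.star_ip]

/-- The left-linear vector field `x ↦ ⟨x†, ω⟩`. -/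
def sharp (h : IsCentredHermitian dag ip) (ω : Ω) : Ω →ₗ[A] A where
  toFun x := ip (dag x) ω
  map_add' x y := by rw [h.dag_add, h.add_left]
  map_smul' a x := by
    rw [h.dag_smul, h.op_smul_left, star_star, RingHom.id_apply, smul_eq_mul]

theorem sharp_apply (h : IsCentredHermitian dag ip) (ω x : Ω) : h.sharp ω x = ip (dag x) ω := rfl

theorem sharp_op_smul (h : IsCentredHermitian dag ip) {ω : Ω} (hω : IsCentralForm A ω)
    (a : A) (x : Ω) : h.sharp ω (op a • x) = h.sharp ω x * a := by
  rw [sharp_apply, sharp_apply, h.dag_op_smul, h.smul_left, star_star, hω, h.smul_right]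

theorem eq_zero_of_ip_left (h : IsCentredHermitian dag ip) {x : Ω} (hx : ∀ y, ip x y = 0) :
    x = 0 := by
  have hdag : dag 0 = 0 := map_zero (AddMonoidHom.mk' dag h.dag_add)
  have hip (y : Ω) : ip 0 y = 0 :=
    map_zero (AddMonoidHom.mk' (ip · y) fun a b => h.add_left a b y)
  have hxy : dag x = 0 := (h.nondeg 0 (by simp) (by simp)).unique
    (fun y => by simp [h.dag_dag, hx]) (fun y => by simp [hdag, hip])
  rw [← h.dag_dag x, hxy, hdag]

theorem eq_of_ip_right (h : IsCentredHermitian dag ip) {x y : Ω} (hxy : ∀ z, ip z x = ip z y) :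
    x = y := by
  refine sub_eq_zero.mp (h.eq_zero_of_ip_left fun z => ?_)
  rw [← h.star_ip, h.sub_right, hxy, sub_self, star_zero]

theorem isCentralForm_dag (h : IsCentredHermitian dag ip) {ω : Ω} (hω : IsCentralForm A ω) :
    IsCentralForm A (dag ω) := fun a => by
  have := congrArg dag (hω (star a))
  rw [h.dag_smul, h.dag_op_smul, star_star] at this
  exact this.symm

/-- Centrality of a form whose vector field is right-linear. -/
theorem isCentralForm_of_sharp (h : IsCentredHermitian dag ip) {ω : Ω}
    (hω : ∀ (a : A) (x : Ω), h.sharp ω (op a • x) = h.sharp ω x * a) : IsCentralForm A ω := by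
  refine fun a => h.eq_of_ip_right fun z => ?_
  have := hω a (dag z)
  rw [sharp_apply, sharp_apply, h.dag_op_smul, h.smul_left, star_star, h.dag_dag] at this
  rw [this, h.smul_right]

theorem smul_right_of_central (h : IsCentredHermitian dag ip) {ω : Ω} (hω : IsCentralForm A ω)
    (a : A) (x : Ω) : ip ω (a • x) = a * ip ω x := by
  have := h.smul_left (star a) ω x
  rw [star_star] at this
  rw [← this, hω, h.op_smul_left, star_star]

theorem ip_eq_ip_dag (h : IsCentredHermitian dag ip) {ω : Ω} (hω : IsCentralForm A ω) (x : Ω) :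
    ip x ω = ip (dag ω) (dag x) := by
  obtain ⟨n, τ, c, hτ, hx⟩ := h.centred (dag x)
  have hx' : ip x ω = h.sharp ω (dag x) := by rw [sharp_apply, h.dag_dag]
  rw [hx', hx, map_sum, h.sum_right]
  refine Finset.sum_congr rfl fun i _ => ?_
  rw [h.sharp_op_smul hω, h.smul_right, sharp_apply, h.symm _ _ (hτ i) hω]

theorem exists_sharp_eq (h : IsCentredHermitian dag ip) {Y : Ω → A} (hY : IsLeftLinVF Y) :
    ∃ ω, ∀ x, Y x = ip (dag x) ω := by
  obtain ⟨ω, hω, -⟩ := h.nondeg (fun x => star (Y (dag x)))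
    (fun x y => by rw [h.dag_add, hY.1, star_add])
    (fun a x => by rw [h.dag_op_smul, hY.2, star_mul, star_star])
  refine ⟨dag ω, fun x => ?_⟩
  have := hω (dag x)
  rw [h.dag_dag] at this
  rw [← star_star (Y x), this, h.star_ip]

/-- Every form is a combination of central forms `τ` with `τ† = -τ`. -/
theorem exists_sum_central_skew [Algebra ℂ A] [StarModule ℂ A] (h : IsCentredHermitian dag ip)
    (v : Ω) : ∃ (n : ℕ) (τ : Fin n → Ω) (c : Fin n → A),
      (∀ i, IsCentralForm A (τ i) ∧ dag (τ i) = -τ i) ∧ v = ∑ i, op (c i) • τ i := by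
  obtain ⟨n, ω, c, hω, rfl⟩ := h.centred v
  have hcomm (z : ℂ) {x : Ω} (hx : IsCentralForm A x) :
      IsCentralForm A (algebraMap ℂ A z • x) := fun a => by
    rw [smul_smul, hx, hx, smul_smul, ← op_mul, Algebra.commutes z a]
  have hsum (i : Fin n) : IsCentralForm A (ω i + dag (ω i)) := fun a => by
    rw [smul_add, smul_add, hω i, h.isCentralForm_dag (hω i)]
  have hstar (z : ℂ) : star (algebraMap ℂ A z) = algebraMap ℂ A (star z) :=
    (algebraMap_star_comm z).symm
  refine ⟨n + n, Fin.append (fun i => ω i - dag (ω i))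
    (fun i => algebraMap ℂ A Complex.I • (ω i + dag (ω i))),
    Fin.append (fun i => algebraMap ℂ A (1 / 2) * c i)
      (fun i => algebraMap ℂ A (-Complex.I / 2) * c i), fun i => ?_, ?_⟩
  · refine Fin.addCases (fun j => ?_) (fun j => ?_) i
    · rw [Fin.append_left]
      refine ⟨fun a => ?_, ?_⟩
      · rw [smul_sub, smul_sub, hω j, h.isCentralForm_dag (hω j)]
      · rw [h.dag_sub, h.dag_dag, neg_sub]
    · rw [Fin.append_right]
      refine ⟨hcomm _ (hsum j), ?_⟩
      rw [h.dag_smul, hstar, h.dag_add, h.dag_dag, add_comm (dag _), ← hsum j, Complex.star_def,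
        Complex.conj_I, map_neg, neg_smul]
  · rw [Fin.sum_univ_add, ← Finset.sum_add_distrib]
    refine Finset.sum_congr rfl fun i _ => ?_
    simp only [Fin.append_left, Fin.append_right]
    rw [op_mul, mul_smul, op_mul, mul_smul, ← smul_add]
    congr 1
    rw [← hcomm _ (hsum i), smul_smul, ← map_mul, show -Complex.I / 2 * Complex.I = (1 / 2 : ℂ) by
      rw [div_mul_eq_mul_div, neg_mul, Complex.I_mul_I, neg_neg], hsum i, ← smul_add,
      sub_add_add_cancel, ← two_smul A, hω, smul_smul,
      ← op_mul, ← map_ofNat (algebraMap ℂ A) 2, ← map_mul]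
    norm_num

/-- A derivation `b ↦ ⟨(db)†, ω⟩` with `ω` central is Hermitian iff `ω† + ω` is orthogonal to all
exact forms. -/
theorem sharp_comp_hermitian_iff (h : IsCentredHermitian dag ip) {d : A → Ω}
    (hd_star : ∀ a : A, d (star a) = -dag (d a)) {ω : Ω} (hω : IsCentralForm A ω) :
    (∀ b, h.sharp ω (d (star b)) = star (h.sharp ω (d b))) ↔
      ∀ b, ip (dag ω) (d b) = -ip ω (d b) := by
  have hl (b : A) : h.sharp ω (d b) = ip (dag ω) (d b) := by
    rw [sharp_apply, h.ip_eq_ip_dag hω, h.dag_dag]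
  have hr (b : A) : star (h.sharp ω (d (star b))) = -ip ω (d b) := by
    rw [sharp_apply, hd_star, h.dag_neg, h.dag_dag, h.neg_left, star_neg, h.star_ip]
  refine ⟨fun H b => ?_, fun H b => ?_⟩
  · rw [← hl, ← hr, ← H, star_star]
  · rw [hl, H, ← hr, star_star]

theorem memDC_sharp [Algebra ℂ A] (h : IsCentredHermitian dag ip) {d : A → Ω}
    (hd_add : ∀ a b : A, d (a + b) = d a + d b)
    (hd_smulC : ∀ (c : ℂ) (a : A), d (c • a) = algebraMap ℂ A c • d a)
    (hd_leibniz : ∀ a b : A, d (a * b) = op b • d a + a • d b)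
    {ω : Ω} (hω : IsCentralForm A ω) : MemDC d (fun b => h.sharp ω (d b)) := by
  refine ⟨fun a b => ?_, fun c a => ?_, fun a b => ?_, fun n a b hab => ?_⟩
  · simp only [hd_add, map_add]
  · beta_reduce
    rw [hd_smulC, map_smul, smul_eq_mul, Algebra.smul_def]
  · beta_reduce
    rw [hd_leibniz, map_add, h.sharp_op_smul hω, map_smul, smul_eq_mul]
  · simpa using congrArg (h.sharp ω) hab

end IsCentredHermitian

/-- Left-linear vector fields agreeing on exact forms are equal. -/
theorem eq_of_eq_on_exact {A : Type*} [Ring A] {Ω : Type*} [AddCommGroup Ω] [Module A Ω]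
    {d : A → Ω} (hgen : ∀ v : Ω, ∃ (n : ℕ) (a b : Fin n → A), v = ∑ i, a i • d (b i))
    {X Y : Ω → A} (hX : IsLeftLinVF X) (hY : IsLeftLinVF Y) (hXY : ∀ b, X (d b) = Y (d b))
    (v : Ω) : X v = Y v := by
  obtain ⟨n, a, b, rfl⟩ := hgen v
  have hsum {Z : Ω → A} (hZ : IsLeftLinVF Z) :
      Z (∑ i, a i • d (b i)) = ∑ i, a i * Z (d (b i)) :=
    (map_sum (AddMonoidHom.mk' Z hZ.1) _ _).trans (Finset.sum_congr rfl fun i _ => hZ.2 _ _)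
  simp_rw [hsum hX, hsum hY, hXY]

/-- For a centred Hermitian differential calculus, `φ(D)` generates
`←X(A)` as a right `A`-module and the induced inner product is Hermitian-symmetric on
`φ(D)`; that is, `(←X(A), ⟨·,·⟩, (D,φ))` is a right real metric calculus. -/
theorem right_real_metric_calculus
    {A : Type*} [Ring A] [Algebra ℂ A] [StarRing A] [StarModule ℂ A]
    {Ω : Type*} [AddCommGroup Ω] [Module A Ω] [Module Aᵐᵒᵖ Ω] [SMulCommClass A Aᵐᵒᵖ Ω]
    [Module.Finite Aᵐᵒᵖ Ω] [Module.Projective Aᵐᵒᵖ Ω]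
    (dag : Ω → Ω)
    (hdag_add : ∀ x y : Ω, dag (x + y) = dag x + dag y)
    (hdag_invol : ∀ x : Ω, dag (dag x) = x)
    (hdag_bimod : ∀ (a b : A) (x : Ω), dag (a • (op b • x)) = star b • (op (star a) • dag x))
    (ip : Ω → Ω → A)
    (hip_addl : ∀ x y z : Ω, ip (x + y) z = ip x z + ip y z)
    (hip_addr : ∀ x y z : Ω, ip x (y + z) = ip x y + ip x z)
    (hip_smulr : ∀ (a : A) (x y : Ω), ip x (op a • y) = ip x y * a)
    (hip_star : ∀ x y : Ω, star (ip x y) = ip y x)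
    (hip_smull : ∀ (a : A) (x y : Ω), ip (a • x) y = ip x (star a • y))
    (hip_nondeg : ∀ f : Ω → A, (∀ x y : Ω, f (x + y) = f x + f y) →
      (∀ (a : A) (x : Ω), f (op a • x) = f x * a) →
      ∃! ω : Ω, ∀ η : Ω, f η = ip (dag ω) η)
    (d : A → Ω)
    (hd_add : ∀ a b : A, d (a + b) = d a + d b)
    (hd_smulC : ∀ (c : ℂ) (a : A), d (c • a) = algebraMap ℂ A c • d a)
    (hd_leibniz : ∀ a b : A, d (a * b) = op b • d a + a • d b)
    (hd_star : ∀ a : A, d (star a) = - dag (d a))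
    (hgen : ∀ v : Ω, ∃ (n : ℕ) (a b : Fin n → A), v = ∑ i, a i • d (b i))
    -- `Ω` is centred
    (hcentred : ∀ v : Ω, ∃ (n : ℕ) (ω : Fin n → Ω) (c : Fin n → A),
      (∀ i, ∀ a : A, a • ω i = op a • ω i) ∧ v = ∑ i, op (c i) • ω i)
    -- the quantum metric is symmetric on central forms
    (hsymm : ∀ ω η : Ω, (∀ a : A, a • ω = op a • ω) → (∀ a : A, a • η = op a • η) →
      ip (dag ω) η = ip (dag η) ω)
    -- `Φ` encodes the isomorphism `φ : D_ℂ → {bilinear vector fields}`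
    (Φ : (A → A) → (Ω → A))
    (hΦ : ∀ δ : A → A, MemDC d δ →
      IsBilinearVF (Φ δ) ∧ ∀ a b : A, Φ δ (a • d b) = a * δ b) :
    -- (1) `φ(D)` generates the left-linear vector fields as a right `A`-module
    (∀ Y : Ω → A, IsLeftLinVF Y →
      ∃ (n : ℕ) (δ : Fin n → (A → A)) (c : Fin n → A),
        (∀ i, MemDC d (δ i) ∧ ∀ a : A, δ i (star a) = star (δ i a)) ∧
        ∀ ω : Ω, Y ω = ∑ i, Φ (δ i) ω * c i) ∧
    -- (2) the induced inner product is Hermitian-symmetric on `φ(D)`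
    (∀ δ₁ δ₂ : A → A,
      MemDC d δ₁ → (∀ a : A, δ₁ (star a) = star (δ₁ a)) →
      MemDC d δ₂ → (∀ a : A, δ₂ (star a) = star (δ₂ a)) →
      ∀ ω₁ ω₂ : Ω,
        (∀ η : Ω, ip (dag η) ω₁ = Φ δ₁ η) → (∀ η : Ω, ip (dag η) ω₂ = Φ δ₂ η) →
        star (ip ω₁ ω₂) = ip ω₁ ω₂) := by
  have h : IsCentredHermitian dag ip := ⟨hdag_add, hdag_invol, hdag_bimod, hip_addl, hip_addr,
    hip_smulr, hip_star, hip_smull, hip_nondeg, hcentred, hsymm⟩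
  constructor
  · intro Y hY
    obtain ⟨v, hv⟩ := h.exists_sharp_eq hY
    obtain ⟨n, τ, c, hτ, rfl⟩ := h.exists_sum_central_skew v
    have hmem (i : Fin n) : MemDC d (fun b => h.sharp (τ i) (d b)) :=
      h.memDC_sharp hd_add hd_smulC hd_leibniz (hτ i).1
    refine ⟨n, fun i b => h.sharp (τ i) (d b), c, fun i => ⟨hmem i, ?_⟩, fun ω => ?_⟩
    · exact (h.sharp_comp_hermitian_iff hd_star (hτ i).1).mpr
        fun b => by rw [(hτ i).2, h.neg_left]
    · rw [hv, h.sum_right]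
      refine Finset.sum_congr rfl fun i _ => ?_
      rw [h.smul_right, ← h.sharp_apply]
      obtain ⟨⟨hadd, hsmul, -⟩, hd⟩ := hΦ _ (hmem i)
      rw [eq_of_eq_on_exact hgen ⟨hadd, hsmul⟩
        ⟨map_add (h.sharp (τ i)), map_smul (h.sharp (τ i))⟩ fun b => ?_]
      simpa using hd 1 b
  · intro δ₁ δ₂ hm₁ hs₁ hm₂ hs₂ ω₁ ω₂ h₁ h₂
    have key (δ : A → A) (hm : MemDC d δ) (hs : ∀ a, δ (star a) = star (δ a)) (ω : Ω)
        (hω : ∀ η, ip (dag η) ω = Φ δ η) : IsCentralForm A ω ∧ dag ω = -ω := by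
      obtain ⟨⟨-, -, hr⟩, hd⟩ := hΦ δ hm
      have hc : IsCentralForm A ω := h.isCentralForm_of_sharp fun a x => by
        rw [h.sharp_apply, h.sharp_apply, hω, hω, hr]
      have hδ (b : A) : h.sharp ω (d b) = δ b := by
        rw [h.sharp_apply, hω]
        simpa using hd 1 b
      have hskew := (h.sharp_comp_hermitian_iff hd_star hc).mp fun b => by rw [hδ, hδ, hs]
      refine ⟨hc, ?_⟩
      have hcd := h.isCentralForm_dag hc
      have hlin : ip (dag ω) = fun x => -ip ω x :=
        funext <| eq_of_eq_on_exact hgen ⟨h.add_right _, h.smul_right_of_central hcd⟩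
          ⟨fun x y => by simp only [h.add_right, neg_add],
            fun a x => by simp only [h.smul_right_of_central hc, mul_neg]⟩ hskew
      refine eq_neg_of_add_eq_zero_left (h.eq_zero_of_ip_left fun y => ?_)
      rw [h.add_left, hlin, neg_add_cancel]
    obtain ⟨hc₁, hd₁⟩ := key δ₁ hm₁ hs₁ ω₁ h₁
    obtain ⟨hc₂, hd₂⟩ := key δ₂ hm₂ hs₂ ω₂ h₂
    have := hsymm ω₁ ω₂ hc₁ hc₂
    rw [hd₁, hd₂, h.neg_left, h.neg_left, neg_inj] at this
    rw [hip_star, this]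
end
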